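/- Let T = {τ_1,…,τ_{3t}} be a finite set of 3t terminals and S = {σ_1,…,σ_s} a family of 3-element subsets of T, with σ_i = {σ_{i1},σ_{i2},σ_{i3}}. Let N = {#_{ij}, #'_{ij} : 1 ≤ i ≤ s, 1 ≤ j ≤ 3} be a set of 6s fresh elements disjoint from T, set T' = T ∪ N, and set S' = { {#_{ij}, #'_{ij}, σ_{ij}} : 1 ≤ i ≤ s, 1 ≤ j ≤ 3 } ∪ { {#_{i1},#_{i2},#_{i3}}, {#'_{i1},#'_{i2},#'_{i3}} : 1 ≤ i ≤ s }. Then: (a) any two distinct members of S' intersect in at most one element; and (b) T admits an exact cover by members of S if and only if T' admits an exact cover by members of S'. -/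

import Mathlib

namespace NFG

/-- An exact cover of `X` by the subfamily of `F` indexed by `C`: every element of `X`
belongs to exactly one chosen member. -/
def IsExactCover {β ι : Type*} (X : Finset β) (F : ι → Finset β) (C : Set ι) : Prop :=
  ∀ x ∈ X, ∃! i : ι, i ∈ C ∧ x ∈ F i

variable {α : Type*} [DecidableEq α]

/-- The members of the `RX3C` family `S'`: an index `inl (i,j)` stands for the triple
`{#_{ij}, #'_{ij}, σ_{ij}}`, and an index `inr (i,b)` stands for `{#_{i1},#_{i2},#_{i3}}`
(for `b = false`) or `{#'_{i1},#'_{i2},#'_{i3}}` (for `b = true`). Fresh elements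
`#_{ij}, #'_{ij}` are encoded as `Sum.inr (i, j, b)`. -/
def SFamily {s : ℕ} (sig : Fin s → Fin 3 → α) :
    (Fin s × Fin 3) ⊕ (Fin s × Bool) → Finset (α ⊕ (Fin s × Fin 3 × Bool))
  | Sum.inl (i, j) => {Sum.inr (i, j, false), Sum.inr (i, j, true), Sum.inl (sig i j)}
  | Sum.inr (i, b) => {Sum.inr (i, 0, b), Sum.inr (i, 1, b), Sum.inr (i, 2, b)}

/-- The new set of terminals `T' = T ∪ N`. -/
def TFamily {s : ℕ} (T : Finset α) : Finset (α ⊕ (Fin s × Fin 3 × Bool)) :=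
  T.image Sum.inl ∪ (Finset.univ : Finset (Fin s × Fin 3 × Bool)).image Sum.inr

theorem inr_mem_SFamily {s : ℕ} (sig : Fin s → Fin 3 → α) (i : Fin s) (j : Fin 3) (b : Bool)
    (k : (Fin s × Fin 3) ⊕ (Fin s × Bool)) :
    Sum.inr (i, j, b) ∈ SFamily sig k ↔ k = Sum.inl (i, j) ∨ k = Sum.inr (i, b) := by
  rcases k with ⟨i', j'⟩ | ⟨i', b'⟩
  · cases b <;> simp [SFamily] <;> grind
  · fin_cases j <;> simp [SFamily] <;> grind

theorem inl_mem_SFamily {s : ℕ} (sig : Fin s → Fin 3 → α) (a : α)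
    (k : (Fin s × Fin 3) ⊕ (Fin s × Bool)) :
    Sum.inl a ∈ SFamily sig k ↔ ∃ i j, k = Sum.inl (i, j) ∧ sig i j = a := by
  rcases k with ⟨i', j'⟩ | ⟨i', b'⟩
  · simp [SFamily]; grind
  · simp [SFamily]

/-- the reduction from `X3C` to `RX3C`: given `T` with `|T| = 3t` and a
family `S` of triples `σ_i = {σ_{i1}, σ_{i2}, σ_{i3}} ⊆ T`, the constructed family `S'`
over `T' = T ∪ N` has pairwise intersections of size at most one, and `T` has an exact
cover by members of `S` iff `T'` has an exact cover by members of `S'`. -/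
theorem x3c_to_rx3c
    (t s : ℕ) (T : Finset α) (hT : T.card = 3 * t)
    (sig : Fin s → Fin 3 → α)
    (hinj : ∀ i : Fin s, Function.Injective (sig i))
    (hmem : ∀ (i : Fin s) (j : Fin 3), sig i j ∈ T) :
    (∀ x y : (Fin s × Fin 3) ⊕ (Fin s × Bool), x ≠ y →
        (SFamily sig x ∩ SFamily sig y).card ≤ 1) ∧
    ((∃ C : Set (Fin s),
        IsExactCover T (fun i => {sig i 0, sig i 1, sig i 2}) C) ↔
     (∃ C' : Set ((Fin s × Fin 3) ⊕ (Fin s × Bool)),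
        IsExactCover (TFamily (s := s) T) (SFamily sig) C')) := by
  refine ⟨?_, ?_, ?_⟩
  · intro x y hxy
    rw [Finset.card_le_one]
    intro a ha b hb
    rw [Finset.mem_inter] at ha hb
    obtain ⟨ha1, ha2⟩ := ha
    obtain ⟨hb1, hb2⟩ := hb
    rcases a with a | ⟨i, j, c⟩ <;> rcases b with b | ⟨i', j', c'⟩ <;>
      simp only [inl_mem_SFamily, inr_mem_SFamily] at ha1 ha2 hb1 hb2 <;> grind
  · rintro ⟨C, hC⟩
    refine ⟨{k | (∃ i j, k = Sum.inl (i, j) ∧ i ∈ C) ∨ (∃ i b, k = Sum.inr (i, b) ∧ i ∉ C)}, ?_⟩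
    rintro (a | ⟨i, j, b⟩) hx
    · have ha : a ∈ T := by simpa [TFamily] using hx
      obtain ⟨i, ⟨hi, hai⟩, hu⟩ := hC a ha
      have hj : ∃ j, sig i j = a := by
        simp only [Finset.mem_insert, Finset.mem_singleton] at hai
        grind
      obtain ⟨j, hj⟩ := hj
      refine ⟨Sum.inl (i, j), ⟨Or.inl ⟨i, j, rfl, hi⟩, (inl_mem_SFamily _ _ _).2 ⟨i, j, rfl, hj⟩⟩, ?_⟩
      rintro k ⟨hk, hk2⟩
      obtain ⟨i', j', rfl, h'⟩ := (inl_mem_SFamily _ _ _).1 hk2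
      have hi' : i' ∈ C := by
        simp only [Set.mem_setOf_eq] at hk
        grind
      have : i' = i := hu i' ⟨hi', by subst h'; fin_cases j' <;> simp⟩
      subst this
      rw [hinj i' (h'.trans hj.symm)]
    · simp only [inr_mem_SFamily, Set.mem_setOf_eq]
      by_cases hi : i ∈ C
      · refine ⟨Sum.inl (i, j), ?_, ?_⟩ <;> grind
      · refine ⟨Sum.inr (i, b), ?_, ?_⟩ <;> grind
  · rintro ⟨C', hC⟩
    have key : ∀ i j b, (Sum.inl (i, j) ∈ C' ↔ Sum.inr (i, b) ∉ C') := by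
      intro i j b
      obtain ⟨k, ⟨hk, hk2⟩, hu⟩ := hC (Sum.inr (i, j, b)) (by simp [TFamily])
      simp only [inr_mem_SFamily] at hk2 hu
      have h1 := hu (Sum.inl (i, j))
      have h2 := hu (Sum.inr (i, b))
      grind
    have key2 : ∀ i j, (Sum.inl (i, j) ∈ C' ↔ Sum.inl (i, 0) ∈ C') := fun i j =>
      (key i j false).trans (key i 0 false).symm
    refine ⟨{i | Sum.inl (i, 0) ∈ C'}, ?_⟩
    intro a ha
    obtain ⟨k, ⟨hk, hk2⟩, hu⟩ := hC (Sum.inl a) (by simpa [TFamily] using ha)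
    obtain ⟨i, j, rfl, rfl⟩ := (inl_mem_SFamily _ _ _).1 hk2
    refine ⟨i, ⟨(key2 i j).1 hk, by fin_cases j <;> simp⟩, ?_⟩
    rintro i' ⟨hi', hm⟩
    have hj : ∃ j', sig i' j' = sig i j := by
      simp only [Finset.mem_insert, Finset.mem_singleton] at hm
      grind
    obtain ⟨j', hj'⟩ := hj
    have := hu (Sum.inl (i', j')) ⟨(key2 i' j').2 hi', (inl_mem_SFamily _ _ _).2 ⟨i', j', rfl, hj'⟩⟩
    grind

end NFG
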